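/- (Theorem 2, two-player case.) Consider the 2×2 game with action sets A_1 = A_2 = {x_1, x_2} and payoffs u_1(x_1,x_1) = 2, u_2(x_1,x_1) = 1, u_1(x_2,x_2) = 1, u_2(x_2,x_2) = 2, and u_1 = u_2 = 0 on the off-diagonal profiles. Then MARC fails in this game: there is no pair of mixed strategies (s_1, s_2) such that simultaneously (i) s_1 is a best response to s_2 and s_2 is a best response to s_1, and (ii) s_1 solves player 1's Definition-4 problem and s_2 solves player 2's Definition-4 problem. -/

import Mathlib

/-- A mixed strategy: nonnegative weights summing to one. -/
def IsMixed {α : Type*} [Fintype α] (s : α → ℝ) : Prop :=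
  (∀ a, 0 ≤ s a) ∧ ∑ a, s a = 1

/-- Expected payoff in a two-player game with payoff function `u`. -/
noncomputable def U {α β : Type*} [Fintype α] [Fintype β]
    (u : α → β → ℝ) (t₁ : α → ℝ) (t₂ : β → ℝ) : ℝ :=
  ∑ a, ∑ b, t₁ a * t₂ b * u a b

/-- `s₁` is a (mixed) best response of player 1 to `t₂`. -/
def IsBR1 {α β : Type*} [Fintype α] [Fintype β]
    (u₁ : α → β → ℝ) (s₁ : α → ℝ) (t₂ : β → ℝ) : Prop :=
  IsMixed s₁ ∧ ∀ t₁, IsMixed t₁ → U u₁ t₁ t₂ ≤ U u₁ s₁ t₂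

/-- `s₂` is a (mixed) best response of player 2 to `t₁`. -/
def IsBR2 {α β : Type*} [Fintype α] [Fintype β]
    (u₂ : α → β → ℝ) (t₁ : α → ℝ) (s₂ : β → ℝ) : Prop :=
  IsMixed s₂ ∧ ∀ t₂, IsMixed t₂ → U u₂ t₁ t₂ ≤ U u₂ t₁ s₂

/-- `s₁` solves player 1's Definition-4 problem: player 1 is rational assuming
player 2 is both rational and correct. -/
def Solves1 {α β : Type*} [Fintype α] [Fintype β]
    (u₁ u₂ : α → β → ℝ) (s₁ : α → ℝ) : Prop :=
  IsMixed s₁ ∧ ∃ t₂, IsBR2 u₂ s₁ t₂ ∧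
    ∀ t₁ t₂', IsMixed t₁ → IsBR2 u₂ t₁ t₂' → U u₁ t₁ t₂' ≤ U u₁ s₁ t₂

/-- `s₂` solves player 2's Definition-4 problem: player 2 is rational assuming
player 1 is both rational and correct. -/
def Solves2 {α β : Type*} [Fintype α] [Fintype β]
    (u₁ u₂ : α → β → ℝ) (s₂ : β → ℝ) : Prop :=
  IsMixed s₂ ∧ ∃ t₁, IsBR1 u₁ t₁ s₂ ∧
    ∀ t₂ t₁', IsMixed t₂ → IsBR1 u₁ t₁' t₂ → U u₂ t₁' t₂ ≤ U u₂ t₁ s₂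

/-- `s₁` is a maximin strategy for player 1. -/
def IsMaximin1 {α β : Type*} [Fintype α] [Fintype β]
    (u₁ : α → β → ℝ) (s₁ : α → ℝ) : Prop :=
  IsMixed s₁ ∧ ∀ t₁, IsMixed t₁ →
    sInf {x | ∃ t₂, IsMixed t₂ ∧ U u₁ t₁ t₂ = x} ≤
      sInf {x | ∃ t₂, IsMixed t₂ ∧ U u₁ s₁ t₂ = x}

/-- `s₂` is a maximin strategy for player 2. -/
def IsMaximin2 {α β : Type*} [Fintype α] [Fintype β]
    (u₂ : α → β → ℝ) (s₂ : β → ℝ) : Prop :=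
  IsMixed s₂ ∧ ∀ t₂, IsMixed t₂ →
    sInf {x | ∃ t₁, IsMixed t₁ ∧ U u₂ t₁ t₂ = x} ≤
      sInf {x | ∃ t₁, IsMixed t₁ ∧ U u₂ t₁ s₂ = x}

/-- The pure (Dirac) strategy on action `a`. -/
noncomputable def pureStrat {α : Type*} [DecidableEq α] (a : α) : α → ℝ :=
  fun b => if b = a then 1 else 0

/-- Player 1's payoffs in the counterexample game of Figure 1. -/
noncomputable def cu₁ (a b : Fin 2) : ℝ :=
  if a = 0 ∧ b = 0 then 2 else if a = 1 ∧ b = 1 then 1 else 0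

/-- Player 2's payoffs in the counterexample game of Figure 1. -/
noncomputable def cu₂ (a b : Fin 2) : ℝ :=
  if a = 0 ∧ b = 0 then 1 else if a = 1 ∧ b = 1 then 2 else 0

theorem isMixed_fin_two {s : Fin 2 → ℝ} :
    IsMixed s ↔ 0 ≤ s 0 ∧ 0 ≤ s 1 ∧ s 0 + s 1 = 1 := by
  simp [IsMixed, Fin.forall_fin_two, Fin.sum_univ_two, and_assoc]

theorem U_cu₁ (s t : Fin 2 → ℝ) : U cu₁ s t = 2 * (s 0 * t 0) + s 1 * t 1 := by
  simp [U, cu₁, Fin.sum_univ_two, mul_comm]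

theorem U_cu₂ (s t : Fin 2 → ℝ) : U cu₂ s t = s 0 * t 0 + 2 * (s 1 * t 1) := by
  simp [U, cu₂, Fin.sum_univ_two, mul_comm]

theorem isMixed_pureStrat (a : Fin 2) : IsMixed (pureStrat a) := by
  rw [isMixed_fin_two]
  fin_cases a <;> simp [pureStrat]

theorem isBR2_cu₂_pureStrat_zero : IsBR2 cu₂ (pureStrat 0) (pureStrat 0) := by
  refine ⟨isMixed_pureStrat 0, fun t ht ↦ ?_⟩
  obtain ⟨h0, h1, h⟩ := isMixed_fin_two.1 ht
  simp only [U_cu₂]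
  simp [pureStrat]
  linarith

theorem isBR1_cu₁_pureStrat_one : IsBR1 cu₁ (pureStrat 1) (pureStrat 1) := by
  refine ⟨isMixed_pureStrat 1, fun t ht ↦ ?_⟩
  obtain ⟨h0, h1, h⟩ := isMixed_fin_two.1 ht
  simp only [U_cu₁]
  simp [pureStrat]
  linarith

/-- Player 1 can secure the maximal payoff 2 only by playing the first action surely. -/
theorem Solves1.apply_one_eq_zero {s : Fin 2 → ℝ} (h : Solves1 cu₁ cu₂ s) : s 1 = 0 := by
  obtain ⟨hs, t, ⟨ht, -⟩, hmax⟩ := h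
  have hU := hmax _ _ (isMixed_pureStrat 0) isBR2_cu₂_pureStrat_zero
  simp only [U_cu₁] at hU
  simp [pureStrat] at hU
  obtain ⟨hs0, hs1, hs⟩ := isMixed_fin_two.1 hs
  obtain ⟨ht0, ht1, ht⟩ := isMixed_fin_two.1 ht
  have h0 : s 0 * t 0 ≤ s 0 := mul_le_of_le_one_right hs0 (by linarith)
  have h1 : s 1 * t 1 ≤ s 1 := mul_le_of_le_one_right hs1 (by linarith)
  linarith

/-- Player 2 can secure the maximal payoff 2 only by playing the second action surely. -/
theorem Solves2.apply_zero_eq_zero {s : Fin 2 → ℝ} (h : Solves2 cu₁ cu₂ s) : s 0 = 0 := by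
  obtain ⟨hs, t, ⟨ht, -⟩, hmax⟩ := h
  have hU := hmax _ _ (isMixed_pureStrat 1) isBR1_cu₁_pureStrat_one
  simp only [U_cu₂] at hU
  simp [pureStrat] at hU
  obtain ⟨hs0, hs1, hs⟩ := isMixed_fin_two.1 hs
  obtain ⟨ht0, ht1, ht⟩ := isMixed_fin_two.1 ht
  have h0 : t 0 * s 0 ≤ s 0 := mul_le_of_le_one_left hs0 (by linarith)
  have h1 : t 1 * s 1 ≤ s 1 := mul_le_of_le_one_left hs1 (by linarith)
  linarith

/-- Theorem 2 (two-player case): MARC fails in the game of Figure 1: no pair of mixed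
strategies consists of mutual best responses while each strategy also solves the
corresponding player's Definition-4 problem. -/
theorem marc_fails_counterexample :
    ¬ ∃ (s₁ s₂ : Fin 2 → ℝ),
        (IsBR1 cu₁ s₁ s₂ ∧ IsBR2 cu₂ s₁ s₂) ∧
        (Solves1 cu₁ cu₂ s₁ ∧ Solves2 cu₁ cu₂ s₂) := by
  rintro ⟨s₁, s₂, ⟨⟨-, hbr⟩, hs₂, -⟩, hsol₁, hsol₂⟩
  have h₁ := hsol₁.apply_one_eq_zero
  have h₂ := hsol₂.apply_zero_eq_zero
  obtain ⟨-, -, hsum⟩ := isMixed_fin_two.1 hs₂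
  have hU := hbr _ (isMixed_pureStrat 1)
  simp only [U_cu₁, h₁, h₂] at hU
  simp [pureStrat] at hU
  linarith
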